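/- arXiv:2506.04007 — 2 statements merged into one kernel-verified Lean document; each statement's English description precedes it below -/
import Mathlib

section
/- In S_n, if a permutation σ has cycle type λ = [1^{m₁} 2^{m₂} ...] with all m_{2k} even, then the number of square roots of σ is ∏_{k odd} ( Σ_{i=0}^{⌊m_k/2⌋} m_k!/(i!·(m_k−2i)!) · (k/2)^i ) · ∏_{k≥1} m_{2k}! · k^{m_{2k}/2} / (m_{2k}/2)!. -/
open Function Finset

/-- Number of square roots of a permutation with `m` cycles, all of length `k`. -/
def sqA (k : ℕ) : ℕ → ℕ
  | 0 => 1
  | 1 => if Odd k then 1 else 0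
  | m + 2 => (if Odd k then sqA k (m + 1) else 0) + k * (m + 1) * sqA k m

def tt (r : ℚ) (m i : ℕ) : ℚ :=
  if 2 * i ≤ m then ((m.factorial : ℚ) / ((i.factorial : ℚ) * ((m - 2 * i).factorial : ℚ))) * r ^ i
  else 0

lemma tt_rec (r : ℚ) (m i : ℕ) :
    tt r (m + 2) (i + 1) = tt r (m + 1) (i + 1) + 2 * r * (m + 1) * tt r m i := by
  unfold tt
  rcases lt_trichotomy (2 * i) m with h | h | h
  · obtain ⟨d, rfl⟩ : ∃ d, m = 2 * i + (d + 1) := ⟨m - 2 * i - 1, by omega⟩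
    rw [if_pos (by omega), if_pos (by omega), if_pos (by omega)]
    have e1 : 2 * i + (d + 1) + 2 - 2 * (i + 1) = d + 1 := by omega
    have e2 : 2 * i + (d + 1) + 1 - 2 * (i + 1) = d := by omega
    have e3 : 2 * i + (d + 1) - 2 * i = d + 1 := by omega
    rw [e1, e2, e3, Nat.factorial_succ (2 * i + (d + 1) + 1), Nat.factorial_succ (2 * i + (d + 1)),
      Nat.factorial_succ i, Nat.factorial_succ d]
    have h1 := Nat.factorial_ne_zero i
    have h2 := Nat.factorial_ne_zero d
    push_cast
    field_simp
    ring
  · subst h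
    rw [if_pos (by omega), if_neg (by omega), if_pos (by omega)]
    have e1 : 2 * i + 2 - 2 * (i + 1) = 0 := by omega
    have e3 : 2 * i - 2 * i = 0 := by omega
    rw [e1, e3, Nat.factorial_succ (2 * i + 1), Nat.factorial_succ (2 * i),
      Nat.factorial_succ i]
    have h1 := Nat.factorial_ne_zero i
    push_cast
    field_simp
    ring
  · rw [if_neg (by omega), if_neg (by omega), if_neg (by omega)]
    simp

lemma tt_zero (r : ℚ) (m : ℕ) : tt r m 0 = 1 := by
  simp [tt, Nat.factorial_ne_zero]

lemma tt_big (r : ℚ) (m i : ℕ) (h : m < 2 * i) : tt r m i = 0 := by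
  simp [tt, h]

lemma sum_tt (r : ℚ) (m M : ℕ) (h : m / 2 + 1 ≤ M) :
    ∑ i ∈ range M, tt r m i = ∑ i ∈ range (m / 2 + 1), tt r m i := by
  symm
  apply Finset.sum_subset
  · intro i; simp; omega
  · intro i _ hi
    apply tt_big
    simp at hi; omega

lemma sqA_odd (k : ℕ) (hk : Odd k) (m : ℕ) :
    (sqA k m : ℚ) = ∑ i ∈ range (m / 2 + 1), tt ((k : ℚ) / 2) m i := by
  induction m using Nat.twoStepInduction with
  | zero => simp [sqA, tt_zero]
  | one => simp [sqA, hk, tt_zero]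
  | more m ih1 ih2 =>
    simp only [sqA, hk, if_true]
    push_cast
    rw [ih1, ih2, ← sum_tt _ (m + 1) (m + 2) (by omega), ← sum_tt _ (m + 2) (m + 2) (by omega),
      ← sum_tt _ m (m + 1) (by omega), sum_range_succ', sum_range_succ' _ (m + 1)]
    simp only [tt_rec, sum_add_distrib, ← mul_sum, tt_zero]
    ring

lemma sqA_odd' (k : ℕ) (hk : Odd k) (m : ℕ) :
    (sqA k m : ℚ) = ∑ i ∈ Finset.range (m / 2 + 1),
            (m.factorial : ℚ) / ((i.factorial : ℚ) * ((m - 2 * i).factorial : ℚ))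
              * ((k : ℚ) / 2) ^ i := by
  rw [sqA_odd k hk]
  apply sum_congr rfl
  intro i hi
  simp at hi
  rw [tt, if_pos (by omega)]

lemma sqA_even (k s : ℕ) : (sqA (2 * k) (2 * s) : ℚ) =
    ((2 * s).factorial : ℚ) * (k : ℚ) ^ s / (s.factorial : ℚ) := by
  induction s with
  | zero => simp [sqA]
  | succ s ih =>
    have : ¬ Odd (2 * k) := by simp
    rw [show 2 * (s + 1) = 2 * s + 2 by ring]
    simp only [sqA, this, if_false, zero_add]
    push_cast
    rw [ih, Nat.factorial_succ (2 * s + 1), Nat.factorial_succ (2 * s), Nat.factorial_succ s]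
    have := Nat.factorial_ne_zero s
    push_cast
    field_simp
    ring

lemma minPer_cycleOf {α : Type*} [Fintype α] [DecidableEq α] (σ : Equiv.Perm α) (x : α)
    (hx : x ∈ σ.support) : minimalPeriod σ x = (σ.cycleOf x).support.card := by
  have hx' := Equiv.Perm.mem_support.1 hx
  have hc := Equiv.Perm.isCycle_cycleOf σ hx'
  have key : ∀ n, minimalPeriod σ x ∣ n ↔ (σ.cycleOf x).support.card ∣ n := by
    intro n
    rw [← isPeriodicPt_iff_minimalPeriod_dvd, ← hc.orderOf, orderOf_dvd_iff_pow_eq_one,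
      hc.pow_eq_one_iff' (x := x) (by simpa using hx'), Equiv.Perm.cycleOf_pow_apply_self]
    rw [IsPeriodicPt, IsFixedPt, Equiv.Perm.iterate_eq_pow]
  exact Nat.dvd_antisymm ((key _).2 dvd_rfl) ((key _).1 dvd_rfl)

lemma count_parts {α : Type*} [Fintype α] [DecidableEq α] (σ : Equiv.Perm α) (j : ℕ) :
    j * Multiset.count j (Equiv.Perm.partition σ).parts =
      Nat.card {z // minimalPeriod σ z = j} := by
  rw [Nat.card_eq_fintype_card, Fintype.card_subtype, Equiv.Perm.parts_partition,
    Multiset.count_add, Multiset.count_replicate]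
  have h1 : j * Multiset.count j σ.cycleType =
      (univ.filter fun z => z ∈ σ.support ∧ minimalPeriod σ z = j).card := by
    rw [Equiv.Perm.cycleType_def, Multiset.count_map]
    change j * (σ.cycleFactorsFinset.filter (fun c => j = c.support.card)).card = _
    have : (univ.filter fun z => z ∈ σ.support ∧ minimalPeriod σ z = j) =
        (σ.cycleFactorsFinset.filter (fun c => j = c.support.card)).biUnion
          (fun c => c.support) := by
      ext z
      simp only [mem_filter, mem_univ, true_and, mem_biUnion]
      constructor
      · rintro ⟨hz, h⟩
        refine ⟨σ.cycleOf z, ⟨Equiv.Perm.cycleOf_mem_cycleFactorsFinset_iff.2 hz, ?_⟩, ?_⟩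
        · rw [← h, minPer_cycleOf σ z hz]
        · rw [Equiv.Perm.mem_support_cycleOf_iff]
          exact ⟨Equiv.Perm.SameCycle.refl _ _, hz⟩
      · rintro ⟨c, ⟨hc, h⟩, hz⟩
        have hz' := Equiv.Perm.mem_cycleFactorsFinset_support_le hc hz
        refine ⟨hz', ?_⟩
        rw [minPer_cycleOf σ z hz', ← Equiv.Perm.cycle_is_cycleOf hz hc, h]
    rw [this, card_biUnion]
    · rw [sum_congr rfl (g := fun _ => j)]
      · simp [mul_comm]
      · intro c hc
        exact (mem_filter.1 hc).2.symm
    · intro c hc d hd hcd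
      exact (Equiv.Perm.cycleFactorsFinset_pairwise_disjoint σ (mem_filter.1 hc).1
        (mem_filter.1 hd).1 hcd).disjoint_support
  have h2 : (if 1 = j then Fintype.card α - σ.support.card else 0) * j =
      (univ.filter fun z => z ∉ σ.support ∧ minimalPeriod σ z = j).card := by
    by_cases hj : 1 = j
    · subst hj
      rw [if_pos rfl, mul_one, ← card_compl]
      congr 1
      ext z
      simp [minimalPeriod_eq_one_iff_isFixedPt, IsFixedPt]
    · rw [if_neg hj, zero_mul]
      symm
      rw [card_eq_zero, filter_eq_empty_iff]
      rintro z - ⟨hz, h⟩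
      apply hj
      rw [← h]; symm
      rw [minimalPeriod_eq_one_iff_isFixedPt, IsFixedPt]
      simpa using hz
  rw [mul_add, h1, mul_comm j, h2]
  rw [← card_filter_add_card_filter_not (s := univ.filter fun z => minimalPeriod σ z = j)
    (fun z => z ∈ σ.support), filter_filter, filter_filter]
  simp only [and_comm]

open Classical in
/-- The forward orbit. -/
noncomputable def orb {α : Type*} (σ : α → α) (x : α) : Finset α :=
  (range (minimalPeriod σ x)).image fun i => σ^[i] x

lemma minPer_pos {α : Type*} [Finite α] {σ : α → α} (hσ : Injective σ) (x : α) :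
    0 < minimalPeriod σ x :=
  minimalPeriod_pos_of_mem_periodicPts (hσ.mem_periodicPts x)

lemma mem_orb {α : Type*} [Finite α] {σ : α → α} (hσ : Injective σ) {x y : α} :
    y ∈ orb σ x ↔ ∃ i, σ^[i] x = y := by
  classical
  simp only [orb, mem_image, mem_range]
  constructor
  · rintro ⟨i, -, h⟩; exact ⟨i, h⟩
  · rintro ⟨i, h⟩
    exact ⟨i % minimalPeriod σ x, Nat.mod_lt _ (minPer_pos hσ x), by
      rw [iterate_mod_minimalPeriod_eq, h]⟩

lemma card_orb {α : Type*} (σ : α → α) (x : α) : (orb σ x).card = minimalPeriod σ x := by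
  classical
  rw [orb, card_image_of_injOn, card_range]
  intro i hi j hj h
  exact iterate_injOn_Iio_minimalPeriod (by simpa using hi) (by simpa using hj) h

lemma iter_eq_iff {α : Type*} [Finite α] {σ : α → α} (hσ : Injective σ) (x : α) (a b : ℕ) :
    σ^[a] x = σ^[b] x ↔ a ≡ b [MOD minimalPeriod σ x] := by
  rw [← iterate_mod_minimalPeriod_eq (n := a), ← iterate_mod_minimalPeriod_eq (n := b),
    iterate_eq_iterate_iff_of_lt_minimalPeriod (Nat.mod_lt _ (minPer_pos hσ x))
      (Nat.mod_lt _ (minPer_pos hσ x))]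
  rfl

lemma orb_inv {α : Type*} [Finite α] {σ : α → α} (hσ : Injective σ) (x z : α) :
    σ z ∈ orb σ x ↔ z ∈ orb σ x := by
  rw [mem_orb hσ, mem_orb hσ]
  constructor
  · rintro ⟨i, h⟩
    rcases i with _ | i
    · refine ⟨minimalPeriod σ x - 1, hσ ?_⟩
      rw [← iterate_succ_apply' σ, Nat.succ_eq_add_one, Nat.sub_add_cancel (minPer_pos hσ x),
        iterate_minimalPeriod, ← h]
      rfl
    · rw [iterate_succ_apply'] at h
      exact ⟨i, hσ h⟩
  · rintro ⟨i, rfl⟩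
    exact ⟨i + 1, iterate_succ_apply' _ _ _⟩

lemma minPer_of_mem_orb {α : Type*} [Finite α] {σ : α → α} (hσ : Injective σ) {x z : α}
    (h : z ∈ orb σ x) : minimalPeriod σ z = minimalPeriod σ x := by
  obtain ⟨i, rfl⟩ := (mem_orb hσ).1 h
  exact minimalPeriod_apply_iterate (hσ.mem_periodicPts x) i

/-- Restriction of `σ` to the complement of an invariant set. -/
def restr {α : Type*} (σ : α → α) (S : Finset α) (hS : ∀ z, σ z ∈ S ↔ z ∈ S) :
    {z // z ∉ S} → {z // z ∉ S} := fun z => ⟨σ z.1, fun h => z.2 ((hS _).1 h)⟩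

lemma restr_inj {α : Type*} {σ : α → α} (hσ : Injective σ) (S : Finset α)
    (hS : ∀ z, σ z ∈ S ↔ z ∈ S) : Injective (restr σ S hS) := by
  intro a b h
  exact Subtype.ext (hσ (congrArg Subtype.val h))

lemma minPer_semiconj {α β : Type*} {σ : α → α} {ρ : β → β} {f : β → α} (hf : Injective f)
    (h : Semiconj f ρ σ) (z : β) : minimalPeriod σ (f z) = minimalPeriod ρ z := by
  rw [minimalPeriod_eq_minimalPeriod_iff]
  intro n
  rw [IsPeriodicPt, IsPeriodicPt, IsFixedPt, IsFixedPt, ← (h.iterate_right n).eq]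
  exact hf.eq_iff

lemma card_ext {α : Type*} [Finite α] (σ : α → α) (S : Finset α)
    (hS : ∀ z, σ z ∈ S ↔ z ∈ S) (f0 : α → α) (h0 : ∀ z ∈ S, f0 z ∈ S)
    (h00 : ∀ z ∈ S, f0 (f0 z) = σ z) :
    Nat.card {f : α → α // (∀ z, f (f z) = σ z) ∧ ∀ z ∈ S, f z = f0 z} =
    Nat.card {g : {z // z ∉ S} → {z // z ∉ S} // ∀ z, g (g z) = restr σ S hS z} := by
  classical
  have key : ∀ f : α → α, (∀ z, f (f z) = σ z) → (∀ z ∈ S, f z = f0 z) →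
      ∀ z, z ∉ S → f z ∉ S := by
    intro f hf hf0 z hz h
    apply hz
    rw [← hS, ← hf z, hf0 _ h]
    exact h0 _ h
  refine Nat.card_congr
    { toFun := fun f => ⟨fun z => ⟨f.1 z.1, key f.1 f.2.1 f.2.2 z.1 z.2⟩, ?_⟩
      invFun := fun g => ⟨fun z => if h : z ∈ S then f0 z else (g.1 ⟨z, h⟩).1, ?_, ?_⟩
      left_inv := ?_
      right_inv := ?_ }
  · intro z
    exact Subtype.ext (f.2.1 z.1)
  · intro z
    by_cases h : z ∈ S
    · simp [h, h0 z h, h00 z h]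
    · simp only [h, dif_neg, not_false_eq_true]
      rw [dif_neg (g.1 ⟨z, h⟩).2]
      exact congrArg Subtype.val (g.2 ⟨z, h⟩)
  · intro z h
    simp [h]
  · rintro ⟨f, hf, hf0⟩
    apply Subtype.ext
    funext z
    by_cases h : z ∈ S
    · simp [h, hf0 z h]
    · simp [h]
  · rintro ⟨g, hg⟩
    apply Subtype.ext
    funext z
    apply Subtype.ext
    simp [z.2]

/-- multiplicities after removing an invariant set of `s` cycles of length `k` -/
lemma mult_restr {α : Type*} [Finite α] {σ : α → α} (S : Finset α)
    (hS : ∀ z, σ z ∈ S ↔ z ∈ S) (m : ℕ → ℕ)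
    (hm : ∀ j, j * m j = Nat.card {z // minimalPeriod σ z = j}) (k s : ℕ)
    (hk : ∀ z ∈ S, minimalPeriod σ z = k) (hs : S.card = k * s) (j : ℕ) :
    j * (update m k (m k - s)) j =
      Nat.card {z : {z // z ∉ S} // minimalPeriod (restr σ S hS) z = j} := by
  classical
  have := Fintype.ofFinite α
  have e : Nat.card {z : {z // z ∉ S} // minimalPeriod (restr σ S hS) z = j} =
      (univ.filter fun z => minimalPeriod σ z = j ∧ z ∉ S).card := by
    rw [← Fintype.card_subtype, ← Nat.card_eq_fintype_card]
    refine Nat.card_congr ⟨fun z => ⟨z.1.1, ?_, z.1.2⟩, fun z => ⟨⟨z.1, z.2.2⟩, ?_⟩, ?_, ?_⟩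
    · refine Eq.trans ?_ z.2
      exact minPer_semiconj (f := Subtype.val) Subtype.val_injective (fun _ => rfl) _
    · refine Eq.trans ?_ z.2.1
      exact (minPer_semiconj (f := Subtype.val) (ρ := restr σ S hS)
        Subtype.val_injective (fun _ => rfl) ⟨z.1, z.2.2⟩).symm
    · intro z; rfl
    · intro z; rfl
  rw [e]
  have hmj := hm j
  rw [Nat.card_eq_fintype_card, Fintype.card_subtype] at hmj
  by_cases hj : j = k
  · subst hj
    rw [update_self, Nat.mul_sub, hmj, ← hs, ← card_sdiff_of_subset]
    · congr 1
      ext z; simp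
    · intro z hz; simp [hk z hz]
  · rw [update_of_ne hj, hmj]
    congr 1
    ext z
    simp only [mem_filter, mem_univ, true_and]
    refine ⟨fun h => ⟨h, fun hz => hj (h.symm.trans (hk z hz))⟩, fun h => h.1⟩


lemma root_inj {α : Type*} {σ : α → α} (hσ : Injective σ) {f : α → α} (hf : ∀ z, f (f z) = σ z) : Injective f := by
  intro a b h
  apply hσ
  rw [← hf, ← hf, h]

lemma root_comm {α : Type*} {σ : α → α} {f : α → α} (hf : ∀ z, f (f z) = σ z) (n : ℕ) (z : α) :
    f (σ^[n] z) = σ^[n] (f z) := by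
  have : Semiconj f σ σ := fun z => by rw [← hf z, ← hf (f z)]
  exact (this.iterate_right n).eq z

lemma root_minPer {α : Type*} [Finite α] {σ : α → α} (hσ : Injective σ) {f : α → α} (hf : ∀ z, f (f z) = σ z) (x : α) :
    minimalPeriod σ (f x) = minimalPeriod σ x :=
  minPer_semiconj (root_inj hσ hf) (fun z => by rw [← hf z, ← hf (f z)]) x

/-- case where the root preserves the orbit of `x`: no root unless `k` odd and `y` special. -/
lemma root_orb {α : Type*} [Finite α] {σ : α → α} (hσ : Injective σ) {f : α → α} (hf : ∀ z, f (f z) = σ z) (x : α) (h : f x ∈ orb σ x) :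
    Odd (minimalPeriod σ x) ∧ f x = σ^[(minimalPeriod σ x + 1) / 2] x := by
  obtain ⟨i, hi⟩ := (mem_orb hσ).1 h
  have h2 : σ^[i + i] x = σ^[1] x := by
    rw [iterate_add_apply, hi, ← root_comm hf, hi, hf]; rfl
  rw [iter_eq_iff hσ] at h2
  have hodd : Odd (minimalPeriod σ x) := by
    by_contra hne
    rw [Nat.not_odd_iff_even] at hne
    have h3 := h2.of_dvd hne.two_dvd
    unfold Nat.ModEq at h3
    omega
  refine ⟨hodd, ?_⟩
  rw [← hi, iter_eq_iff hσ]
  set k := minimalPeriod σ x with hk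
  have h4 : 2 * i ≡ 2 * ((k + 1) / 2) [MOD k] := by
    have : 2 * ((k + 1) / 2) = k + 1 := by
      obtain ⟨a, ha⟩ := hodd; omega
    rw [this, two_mul]
    refine h2.trans ?_
    simp [Nat.ModEq]
  exact Nat.ModEq.cancel_left_of_coprime (by simpa [Nat.coprime_comm] using hodd) h4

lemma count_orb {α : Type*} [Finite α] {σ : α → α} (hσ : Injective σ) (x : α) (hodd : Odd (minimalPeriod σ x)) :
    Nat.card {f : α → α // (∀ z, f (f z) = σ z) ∧ f x = σ^[(minimalPeriod σ x + 1) / 2] x} =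
    Nat.card {g : {z // z ∉ orb σ x} → {z // z ∉ orb σ x} //
      ∀ z, g (g z) = restr σ (orb σ x) (orb_inv hσ x) z} := by
  set k := minimalPeriod σ x with hk
  have hk2 : (k + 1) / 2 + (k + 1) / 2 = k + 1 := by
    obtain ⟨a, ha⟩ := hodd; omega
  rw [← card_ext σ (orb σ x) (orb_inv hσ x) (σ^[(k + 1) / 2])]
  · apply Nat.card_congr
    apply Equiv.subtypeEquivRight
    intro f
    apply and_congr_right
    intro hf
    constructor
    · intro h z hz
      obtain ⟨i, rfl⟩ := (mem_orb hσ).1 hz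
      rw [root_comm hf, h, ← iterate_add_apply, ← iterate_add_apply, add_comm]
    · intro h
      exact h x ((mem_orb hσ).2 ⟨0, rfl⟩)
  · intro z hz
    obtain ⟨i, rfl⟩ := (mem_orb hσ).1 hz
    exact (mem_orb hσ).2 ⟨_, iterate_add_apply _ _ _ _⟩
  · intro z hz
    rw [← iterate_add_apply, hk2, hk, ← minPer_of_mem_orb hσ hz, add_comm,
      iterate_add_minimalPeriod_eq]
    rfl

open Classical in
lemma orb2_inv {α : Type*} [Finite α] {σ : α → α} (hσ : Injective σ) (x y z : α) : σ z ∈ orb σ x ∪ orb σ y ↔ z ∈ orb σ x ∪ orb σ y := by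
  rw [mem_union, mem_union, orb_inv hσ, orb_inv hσ]

open Classical in
lemma count_orb2 {α : Type*} [Finite α] {σ : α → α} (hσ : Injective σ) (x y : α) (hxy : minimalPeriod σ y = minimalPeriod σ x) (hy : y ∉ orb σ x) :
    Nat.card {f : α → α // (∀ z, f (f z) = σ z) ∧ f x = y} =
    Nat.card {g : {z // z ∉ orb σ x ∪ orb σ y} → {z // z ∉ orb σ x ∪ orb σ y} //
      ∀ z, g (g z) = restr σ (orb σ x ∪ orb σ y) (orb2_inv hσ x y) z} := by
  have hdis : ∀ i, ¬ ∃ j, σ^[j] x = σ^[i] y := by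
    intro i
    induction i with
    | zero => rw [← mem_orb hσ]; exact hy
    | succ i ih => rw [← mem_orb hσ, iterate_succ_apply', orb_inv hσ, mem_orb hσ]; exact ih
  let f0 : α → α := fun z =>
    if h : ∃ i, σ^[i] x = z then σ^[h.choose] y
    else if h : ∃ i, σ^[i] y = z then σ^[h.choose + 1] x else z
  have fx : ∀ i, f0 (σ^[i] x) = σ^[i] y := by
    intro i
    have h : ∃ j, σ^[j] x = σ^[i] x := ⟨i, rfl⟩
    simp only [f0, dif_pos h]
    have := h.choose_spec
    rw [iter_eq_iff hσ] at this
    rw [iter_eq_iff hσ, hxy]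
    exact this
  have fy : ∀ i, f0 (σ^[i] y) = σ^[i + 1] x := by
    intro i
    have h : ∃ j, σ^[j] y = σ^[i] y := ⟨i, rfl⟩
    simp only [f0, dif_neg (hdis i), dif_pos h]
    have := h.choose_spec
    rw [iter_eq_iff hσ, hxy] at this
    rw [iter_eq_iff hσ]
    exact this.add_right 1
  rw [← card_ext σ (orb σ x ∪ orb σ y) (orb2_inv hσ x y) f0]
  · apply Nat.card_congr
    apply Equiv.subtypeEquivRight
    intro f
    apply and_congr_right
    intro hf
    constructor
    · intro h z hz
      rw [mem_union, mem_orb hσ, mem_orb hσ] at hz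
      rcases hz with ⟨i, rfl⟩ | ⟨i, rfl⟩
      · rw [fx, root_comm hf, h]
      · rw [fy, root_comm hf, ← h, hf]; rfl
    · intro h
      rw [h x (mem_union_left _ ((mem_orb hσ).2 ⟨0, rfl⟩))]
      exact fx 0
  · intro z hz
    rw [mem_union, mem_orb hσ, mem_orb hσ] at hz ⊢
    rcases hz with ⟨i, rfl⟩ | ⟨i, rfl⟩
    · rw [fx]; exact Or.inr ⟨_, rfl⟩
    · rw [fy]; exact Or.inl ⟨_, rfl⟩
  · intro z hz
    rw [mem_union, mem_orb hσ, mem_orb hσ] at hz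
    rcases hz with ⟨i, rfl⟩ | ⟨i, rfl⟩
    · rw [fx, fy, iterate_succ_apply']
    · rw [fy, fx, iterate_succ_apply']



lemma card_fiber {α : Type*} [Fintype α] (P : (α → α) → Prop) (x : α) :
    Nat.card {f // P f} = ∑ y, Nat.card {f // P f ∧ f x = y} := by
  rw [← Nat.card_sigma]
  apply Nat.card_congr
  exact
    { toFun := fun f => ⟨f.1 x, f.1, f.2, rfl⟩
      invFun := fun p => ⟨p.2.1, p.2.2.1⟩
      left_inv := fun f => rfl
      right_inv := by
        rintro ⟨y, f, hf, rfl⟩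
        rfl }

lemma prod_upd (N k v : ℕ) (hk : k ∈ Icc 1 N) (m : ℕ → ℕ) :
    ∏ j ∈ Icc 1 N, sqA j (update m k v j) =
      sqA k v * ∏ j ∈ (Icc 1 N).erase k, sqA j (m j) := by
  rw [← mul_prod_erase _ _ hk, update_self]
  congr 1
  apply prod_congr rfl
  intro j hj
  rw [update_of_ne (ne_of_mem_erase hj)]

theorem main_count (N : ℕ) : ∀ (c : ℕ) (α : Type) [Fintype α] (σ : α → α), Injective σ →
    ∀ (m : ℕ → ℕ), Fintype.card α = c → c ≤ N →
    (∀ j, j * m j = Nat.card {z // minimalPeriod σ z = j}) →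
    Nat.card {f : α → α // ∀ z, f (f z) = σ z} = ∏ k ∈ Icc 1 N, sqA k (m k) := by
  classical
  intro c
  induction c using Nat.strong_induction_on with
  | _ c ih =>
  intro α _ σ hσ m hc hN hm
  rcases isEmpty_or_nonempty α with hα | ⟨⟨x⟩⟩
  · have h1 : ∀ j ∈ Icc 1 N, sqA j (m j) = 1 := by
      intro j hj
      have := hm j
      rw [Nat.card_of_isEmpty] at this
      rw [mem_Icc] at hj
      have h0 : m j = 0 := by
        rcases Nat.mul_eq_zero.1 this with h | h
        · omega
        · exact h
      rw [h0, sqA]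
    rw [prod_congr rfl h1, prod_const_one, Nat.card_eq_one_iff_unique]
    exact ⟨inferInstance, ⟨⟨fun z => z, fun z => isEmptyElim z⟩⟩⟩
  set k := minimalPeriod σ x with hk
  have hkpos : 0 < k := minPer_pos hσ x
  have hkc : k ≤ c := by
    rw [hk, ← card_orb, ← hc]; exact card_le_univ _
  have hkN : k ∈ Icc 1 N := by rw [mem_Icc]; omega
  set R := ∏ j ∈ (Icc 1 N).erase k, sqA j (m j) with hR
  have hmk : k * m k = (univ.filter fun z => minimalPeriod σ z = k).card := by
    rw [hm k, Nat.card_eq_fintype_card, Fintype.card_subtype]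
  have hsub : orb σ x ⊆ univ.filter fun z => minimalPeriod σ z = k := by
    intro z hz
    simp [minPer_of_mem_orb hσ hz, hk]
  have hother : ((univ.filter fun z => minimalPeriod σ z = k) \ orb σ x).card = k * (m k - 1) := by
    rw [card_sdiff_of_subset hsub, ← hmk, card_orb, ← hk, Nat.mul_sub, mul_one]
  have hm1 : 1 ≤ m k := by
    have : k * 1 ≤ k * m k := by
      rw [hmk, mul_one]
      conv_lhs => rw [hk, ← card_orb σ x]
      exact card_le_card hsub
    exact Nat.le_of_mul_le_mul_left this hkpos
  have hrem : ∀ (S : Finset α) (hS : ∀ z, σ z ∈ S ↔ z ∈ S) (s : ℕ),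
      (∀ z ∈ S, minimalPeriod σ z = k) → S.card = k * s → 0 < s →
      Nat.card {g : {z // z ∉ S} → {z // z ∉ S} // ∀ z, g (g z) = restr σ S hS z} =
        sqA k (m k - s) * R := by
    intro S hS s h1 h2 h3
    have hpos : 0 < S.card := by rw [h2]; positivity
    have hcard : Fintype.card {z // z ∉ S} = c - S.card := by
      rw [Fintype.card_subtype_compl, hc, Fintype.card_coe]
    have hle : S.card ≤ c := by rw [← hc]; exact card_le_univ _
    rw [ih (c - S.card) (by omega) {z // z ∉ S} (restr σ S hS) (restr_inj hσ S hS)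
      (update m k (m k - s)) hcard (by omega) (mult_restr S hS m hm k s h1 h2), prod_upd _ _ _ hkN]
  have hT : ∀ y, Nat.card {f : α → α // (∀ z, f (f z) = σ z) ∧ f x = y} =
      (if y = σ^[(k + 1) / 2] x then (if Odd k then sqA k (m k - 1) * R else 0) else 0) +
      (if y ∈ (univ.filter fun z => minimalPeriod σ z = k) \ orb σ x
        then sqA k (m k - 2) * R else 0) := by
    intro y
    by_cases hy : y ∈ orb σ x
    · rw [if_neg (c := y ∈ _ \ _) (by simp [hy]), add_zero]
      by_cases h : y = σ^[(k + 1) / 2] x ∧ Odd k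
      · obtain ⟨rfl, ho⟩ := h
        rw [if_pos rfl, if_pos ho, count_orb hσ x ho,
          hrem _ _ 1 (fun z hz => minPer_of_mem_orb hσ hz) (by rw [card_orb, mul_one]) one_pos]
      · have : IsEmpty {f : α → α // (∀ z, f (f z) = σ z) ∧ f x = y} := by
          constructor
          rintro ⟨f, hf, rfl⟩
          obtain ⟨h1, h2⟩ := root_orb hσ hf x hy
          exact h ⟨h2, h1⟩
        rw [Nat.card_of_isEmpty]
        by_cases h' : y = σ^[(k + 1) / 2] x
        · rw [if_pos h', if_neg (fun ho => h ⟨h', ho⟩)]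
        · rw [if_neg h']
    · rw [if_neg (c := y = _) (fun h => hy ((mem_orb hσ).2 ⟨_, h.symm⟩)), zero_add]
      by_cases hyk : minimalPeriod σ y = k
      · rw [if_pos (by simp [hy, hyk]), count_orb2 hσ x y hyk hy]
        have hdisj : Disjoint (orb σ x) (orb σ y) := by
          rw [disjoint_right]
          intro z hz hz'
          obtain ⟨i, rfl⟩ := (mem_orb hσ).1 hz
          clear hz
          induction i with
          | zero => exact hy hz'
          | succ i ihi =>
            rw [iterate_succ_apply', orb_inv hσ] at hz'
            exact ihi hz'
        apply hrem _ _ 2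
        · intro z hz
          rcases mem_union.1 hz with hz | hz
          · exact minPer_of_mem_orb hσ hz
          · rw [minPer_of_mem_orb hσ hz, hyk]
        · rw [card_union_of_disjoint hdisj, card_orb, card_orb, hyk]; omega
        · norm_num
      · rw [if_neg (by simp [hyk])]
        have : IsEmpty {f : α → α // (∀ z, f (f z) = σ z) ∧ f x = y} := by
          constructor
          rintro ⟨f, hf, rfl⟩
          exact hyk (root_minPer hσ hf x)
        exact Nat.card_of_isEmpty
  rw [card_fiber _ x, sum_congr rfl (fun y _ => hT y), sum_add_distrib, sum_ite_eq' univ,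
    if_pos (mem_univ _), sum_ite_mem, univ_inter, sum_const, hother, smul_eq_mul,
    ← mul_prod_erase _ _ hkN, ← hR]
  obtain ⟨t, ht⟩ : ∃ t, m k = t + 1 := ⟨m k - 1, by omega⟩
  rw [ht]
  rcases t with _ | t
  · simp only [sqA, zero_add, Nat.sub_self, mul_zero, zero_mul, add_zero]
    split_ifs <;> simp
  · simp only [sqA, Nat.add_sub_cancel]
    rw [show t + 1 + 1 - 2 = t by omega]
    split_ifs <;> ring


/-- If `σ ∈ S_n` has cycle type `[1^{m₁} 2^{m₂} ...]` (as a partition of `n`,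
fixed points included) with all `m_{2k}` even, then its number of square roots is
`∏_{k odd} (Σ_{i=0}^{⌊m_k/2⌋} m_k!/(i!(m_k−2i)!) (k/2)^i) · ∏_{k≥1} m_{2k}! k^{m_{2k}/2}/(m_{2k}/2)!`. -/
theorem card_sqrt_of_even_mults (n : ℕ) (σ : Equiv.Perm (Fin n)) (m : ℕ → ℕ)
    (hm : ∀ j, m j = Multiset.count j (Equiv.Perm.partition σ).parts)
    (heven : ∀ k, Even (m (2 * k))) :
    (Nat.card {τ : Equiv.Perm (Fin n) | τ ^ 2 = σ} : ℚ) =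
      (∏ k ∈ (Finset.Icc 1 n).filter (fun k => Odd k),
          ∑ i ∈ Finset.range (m k / 2 + 1),
            ((m k).factorial : ℚ) / ((i.factorial : ℚ) * ((m k - 2 * i).factorial : ℚ))
              * ((k : ℚ) / 2) ^ i) *
        ∏ k ∈ Finset.Icc 1 n,
          ((m (2 * k)).factorial : ℚ) * (k : ℚ) ^ (m (2 * k) / 2)
            / ((m (2 * k) / 2).factorial : ℚ) := by
  have hm' : ∀ j, j * m j = Nat.card {z // minimalPeriod σ z = j} := by
    intro j
    rw [hm j, count_parts]
  have h1 : Nat.card {τ : Equiv.Perm (Fin n) | τ ^ 2 = σ} =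
      Nat.card {f : Fin n → Fin n // ∀ z, f (f z) = σ z} := by
    apply Nat.card_congr
    refine Equiv.ofBijective (fun τ => ⟨fun z => τ.1 z, fun z => ?_⟩) ⟨?_, ?_⟩
    · have := τ.2
      simp only [Set.mem_ofPred_eq] at this
      have h := congrArg (fun ρ : Equiv.Perm (Fin n) => ρ z) this
      simpa [pow_two] using h
    · intro a b h
      apply Subtype.ext
      ext z : 1
      exact congrFun (congrArg Subtype.val h) z
    · rintro ⟨f, hf⟩
      have hfi : Injective f := root_inj σ.injective hf
      refine ⟨⟨Equiv.ofBijective f (Finite.injective_iff_bijective.1 hfi), ?_⟩, ?_⟩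
      · simp only [Set.mem_ofPred_eq]
        ext z : 1
        rw [pow_two, Equiv.Perm.mul_apply]
        exact hf z
      · rfl
  rw [h1, main_count n n (Fin n) σ σ.injective m (Fintype.card_fin n) le_rfl hm',
    ← prod_filter_mul_prod_filter_not (Icc 1 n) (fun k => Odd k)]
  push_cast
  congr 1
  · apply prod_congr rfl
    intro k hk
    exact sqA_odd' k (mem_filter.1 hk).2 _
  · have h2 : ∀ k ∈ Icc 1 n, ((m (2 * k)).factorial : ℚ) * (k : ℚ) ^ (m (2 * k) / 2)
            / ((m (2 * k) / 2).factorial : ℚ) = (sqA (2 * k) (m (2 * k)) : ℚ) := by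
      intro k _
      obtain ⟨s, hs⟩ := heven k
      rw [hs, ← two_mul, sqA_even, Nat.mul_div_cancel_left _ two_pos]
    rw [prod_congr rfl h2,
      ← prod_image (s := Icc 1 n) (g := fun k => 2 * k) (f := fun k => (sqA k (m k) : ℚ))
        (fun a _ b _ h => by simpa using h)]
    apply prod_subset
    · intro k hk
      rw [mem_filter, Nat.not_odd_iff_even, mem_Icc] at hk
      obtain ⟨h, s, rfl⟩ := hk
      rw [mem_image]
      refine ⟨s, by rw [mem_Icc]; omega, by ring⟩
    · intro k hk hk'
      rw [mem_image] at hk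
      obtain ⟨s, hs, rfl⟩ := hk
      rw [mem_filter, mem_Icc] at hk'
      rw [mem_Icc] at hs
      have hgt : n < 2 * s := by
        by_contra hle
        exact hk' ⟨⟨by omega, by omega⟩, by simp⟩
      have h0 : m (2 * s) = 0 := by
        have h3 := hm' (2 * s)
        have h4 : Nat.card {z // minimalPeriod σ z = 2 * s} ≤ n := by
          refine (Nat.card_le_card_of_injective _ Subtype.val_injective).trans ?_
          simp
        by_contra hne
        have : 2 * s * 1 ≤ 2 * s * m (2 * s) := Nat.mul_le_mul_left _ (by omega)
        omega
      simp [h0, sqA]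
end

section
/- Two permutation matrices P_σ and P_τ (for σ, τ ∈ S_n) are conjugate in GL_n(F_q) if and only if σ and τ are conjugate in S_n, i.e., if and only if they have the same cycle type. -/
/-- The gcd matrix is nonsingular. -/
lemma gcdMatrix_inj (n : ℕ) (h : ℕ → ℚ)
    (H : ∀ k ∈ Finset.Icc 1 n, ∑ p ∈ Finset.Icc 1 n, h p * (Nat.gcd p k : ℚ) = 0) :
    ∀ p ∈ Finset.Icc 1 n, h p = 0 := by
  classical
  let S : ℕ → ℚ := fun d => ∑ p ∈ Finset.Icc 1 n, if d ∣ p then h p else 0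
  have hg : ∀ p ∈ Finset.Icc 1 n, ∀ k, (Nat.gcd p k : ℚ) =
      ∑ d ∈ Finset.Icc 1 n, (if d ∣ p then (1 : ℚ) else 0) * (if d ∣ k then 1 else 0) *
        (Nat.totient d : ℚ) := by
    intro p hp k
    rw [Finset.mem_Icc] at hp
    conv_lhs => rw [← Nat.sum_totient (Nat.gcd p k)]
    push_cast
    have hpos : 0 < Nat.gcd p k := Nat.gcd_pos_of_pos_left _ (by omega)
    have hsub : (Nat.gcd p k).divisors ⊆ Finset.Icc 1 n := by
      intro d hd
      have h1 := Nat.pos_of_mem_divisors hd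
      have h2 := Nat.le_of_dvd (by omega)
        ((Nat.dvd_of_mem_divisors hd).trans (Nat.gcd_dvd_left p k))
      rw [Finset.mem_Icc]; omega
    rw [← Finset.sum_subset hsub]
    · refine Finset.sum_congr rfl fun d hd => ?_
      have h1 := Nat.dvd_of_mem_divisors hd
      rw [Nat.dvd_gcd_iff] at h1
      simp [h1.1, h1.2]
    · intro d _ hd
      rw [Nat.mem_divisors, Nat.dvd_gcd_iff] at hd
      by_cases h1 : d ∣ p <;> by_cases h2 : d ∣ k <;> simp [h1, h2]
      exact absurd ⟨⟨h1, h2⟩, hpos.ne'⟩ hd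
  have hS : ∀ d, S d = ∑ p ∈ Finset.Icc 1 n, h p * (if d ∣ p then (1 : ℚ) else 0) := by
    intro d; simp [S]
  have hsq : ∑ d ∈ Finset.Icc 1 n, (Nat.totient d : ℚ) * S d ^ 2 = 0 := by
    have h0 : ∑ k ∈ Finset.Icc 1 n, h k * ∑ p ∈ Finset.Icc 1 n, h p * (Nat.gcd p k : ℚ) = 0 :=
      Finset.sum_eq_zero fun k hk => by rw [H k hk, mul_zero]
    rw [← h0]
    have h1 : ∀ k ∈ Finset.Icc 1 n,
        h k * ∑ p ∈ Finset.Icc 1 n, h p * (Nat.gcd p k : ℚ) =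
        ∑ d ∈ Finset.Icc 1 n, (Nat.totient d : ℚ) * S d *
          (h k * (if d ∣ k then (1 : ℚ) else 0)) := by
      intro k _
      rw [Finset.mul_sum]
      simp only [hS, Finset.mul_sum, Finset.sum_mul]
      rw [Finset.sum_comm]
      refine Finset.sum_congr rfl fun p hp => ?_
      rw [hg p hp k, Finset.mul_sum, Finset.mul_sum]
      exact Finset.sum_congr rfl fun d _ => by ring
    rw [Finset.sum_congr rfl h1, Finset.sum_comm]
    refine Finset.sum_congr rfl fun d _ => ?_
    rw [← Finset.mul_sum, ← hS]; ring
  have hS0 : ∀ d ∈ Finset.Icc 1 n, S d = 0 := by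
    intro d hd
    have h1 := (Finset.sum_eq_zero_iff_of_nonneg (fun d _ => by positivity)).1 hsq d hd
    have h2 : (Nat.totient d : ℚ) ≠ 0 := by
      have := Nat.totient_pos.2 (Finset.mem_Icc.1 hd).1
      exact_mod_cast this.ne'
    simpa [h2] using h1
  have main : ∀ m p, n - p = m → p ∈ Finset.Icc 1 n → h p = 0 := by
    intro m
    induction m using Nat.strong_induction_on with
    | _ m ih =>
      intro p hm hp
      have h1 := hS0 p hp
      simp only [S] at h1
      rw [Finset.sum_eq_single_of_mem p hp] at h1
      · simpa using h1
      · intro q hq hqp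
        split_ifs with hd
        · have := Nat.le_of_dvd (Finset.mem_Icc.1 hq).1 hd
          rw [Finset.mem_Icc] at hq hp
          exact ih (n - q) (by omega) q rfl (Finset.mem_Icc.2 hq)
        · rfl
  exact fun p hp => main _ p rfl hp

open Function

lemma card_sameCycle_class {n : ℕ} (g : Equiv.Perm (Fin n)) (x : Fin n) :
    (Finset.univ.filter fun y => g.SameCycle x y).card = minimalPeriod g x := by
  classical
  have h := MulAction.minimalPeriod_eq_card (a := g) (b := x)
  change minimalPeriod g x = _ at h
  rw [h, ← Set.toFinset_card]
  congr 1
  ext y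
  simp only [Finset.mem_filter, Finset.mem_univ, true_and, Set.mem_toFinset]
  constructor
  · rintro ⟨i, hi⟩
    exact ⟨⟨g ^ i, i, rfl⟩, hi⟩
  · rintro ⟨⟨_, i, rfl⟩, hi⟩
    exact ⟨i, hi⟩

lemma card_quot_eq {n : ℕ} (g : Equiv.Perm (Fin n)) :
    (Nat.card (Quotient (Equiv.Perm.SameCycle.setoid g)) : ℚ) =
      ∑ x, (1 : ℚ) / minimalPeriod g x := by
  classical
  have : Fintype (Quotient (Equiv.Perm.SameCycle.setoid g)) := Fintype.ofFinite _
  rw [← Finset.sum_fiberwise Finset.univ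
    (fun x => (Quotient.mk (Equiv.Perm.SameCycle.setoid g) x))]
  rw [Nat.card_eq_fintype_card, Fintype.card_eq_sum_ones]
  push_cast
  refine Finset.sum_congr rfl fun q _ => ?_
  induction q using Quotient.inductionOn with
  | _ x =>
  have hf : (Finset.univ.filter fun y => Quotient.mk (Equiv.Perm.SameCycle.setoid g) y =
      Quotient.mk (Equiv.Perm.SameCycle.setoid g) x) =
      Finset.univ.filter fun y => g.SameCycle x y := by
    ext y
    simp only [Finset.mem_filter, Finset.mem_univ, true_and]
    rw [Quotient.eq]
    exact ⟨fun h => Equiv.Perm.SameCycle.symm h, fun h => Equiv.Perm.SameCycle.symm h⟩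
  rw [hf]
  have hc : ∀ y ∈ Finset.univ.filter (fun y => g.SameCycle x y),
      (1 : ℚ) / minimalPeriod g y = 1 / minimalPeriod g x := by
    intro y hy
    simp only [Finset.mem_filter, Finset.mem_univ, true_and] at hy
    rw [← card_sameCycle_class, ← card_sameCycle_class]
    congr 3
    ext z
    simp only [Finset.mem_filter, Finset.mem_univ, true_and]
    exact ⟨fun h => hy.trans h, fun h => hy.symm.trans h⟩
  rw [Finset.sum_congr rfl hc, Finset.sum_const, card_sameCycle_class, nsmul_eq_mul]
  have : 0 < minimalPeriod g x := by
    rw [← card_sameCycle_class, Finset.card_pos]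
    exact ⟨x, by simpa using Equiv.Perm.SameCycle.refl _ x⟩
  have : (minimalPeriod g x : ℚ) ≠ 0 := by exact_mod_cast this.ne'
  field_simp

lemma card_fixed (F : Type*) [Field F] [Fintype F] {n : ℕ} (g : Equiv.Perm (Fin n)) :
    Nat.card {v : Fin n → F // v ∘ g = v} =
      Nat.card F ^ Nat.card (Quotient (Equiv.Perm.SameCycle.setoid g)) := by
  rw [← Nat.card_fun]
  refine Nat.card_congr
    { toFun := fun v => Quotient.lift v.1 ?_
      invFun := fun w => ⟨fun x => w (Quotient.mk _ x), ?_⟩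
      left_inv := fun v => rfl
      right_inv := fun w => ?_ }
  · rintro a b hab
    obtain ⟨i, -, rfl⟩ := Equiv.Perm.SameCycle.exists_pow_eq' hab
    clear hab
    induction i with
    | zero => rfl
    | succ i ih =>
      rw [ih, pow_succ', Equiv.Perm.mul_apply]
      exact (congrFun v.2 _).symm
  · funext x
    refine congrArg w (Quotient.sound ?_)
    exact ⟨-1, by simp⟩
  · funext q
    induction q using Quotient.inductionOn with
    | _ x => rfl

lemma permMatrix_pow_mulVec (F : Type*) [Field F] {n : ℕ} (σ : Equiv.Perm (Fin n)) (k : ℕ)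
    (v : Fin n → F) : (σ.permMatrix F ^ k).mulVec v = v ∘ (σ ^ k : Equiv.Perm (Fin n)) := by
  induction k generalizing v with
  | zero => simp
  | succ k ih =>
    rw [pow_succ, ← Matrix.mulVec_mulVec, ih, Matrix.permMatrix_mulVec, pow_succ']
    rfl

lemma card_quot_eq_of_isConj (F : Type*) [Field F] [Fintype F] {n : ℕ}
    (σ τ : Equiv.Perm (Fin n)) (h : IsConj (σ.permMatrix F) (τ.permMatrix F)) (k : ℕ) :
    Nat.card (Quotient (Equiv.Perm.SameCycle.setoid (σ ^ k))) =
    Nat.card (Quotient (Equiv.Perm.SameCycle.setoid (τ ^ k))) := by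
  obtain ⟨c, hc⟩ := h
  have hk := hc.pow_right k
  have hk' : c.1 * σ.permMatrix F ^ k = τ.permMatrix F ^ k * c.1 := hk
  have hk'' : c⁻¹.1 * τ.permMatrix F ^ k = σ.permMatrix F ^ k * c⁻¹.1 := by
    have := hk.units_inv_symm_left
    exact this
  have e : Nat.card {v : Fin n → F // v ∘ (σ ^ k : Equiv.Perm (Fin n)) = v} =
      Nat.card {v : Fin n → F // v ∘ (τ ^ k : Equiv.Perm (Fin n)) = v} := by
    refine Nat.card_congr
      { toFun := fun v => ⟨c.1.mulVec v.1, ?_⟩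
        invFun := fun v => ⟨c⁻¹.1.mulVec v.1, ?_⟩
        left_inv := fun v => Subtype.ext ?_
        right_inv := fun v => Subtype.ext ?_ }
    · rw [← permMatrix_pow_mulVec, Matrix.mulVec_mulVec, ← hk', ← Matrix.mulVec_mulVec,
        permMatrix_pow_mulVec, v.2]
    · rw [← permMatrix_pow_mulVec, Matrix.mulVec_mulVec, ← hk'', ← Matrix.mulVec_mulVec,
        permMatrix_pow_mulVec, v.2]
    · simp [Matrix.mulVec_mulVec]
    · simp [Matrix.mulVec_mulVec]
  rw [card_fixed, card_fixed] at e
  refine Nat.pow_right_injective ?_ e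
  rw [Nat.card_eq_fintype_card]
  exact Fintype.one_lt_card

lemma minimalPeriod_perm_pos {n : ℕ} (σ : Equiv.Perm (Fin n)) (x : Fin n) :
    0 < minimalPeriod σ x := by
  rw [← card_sameCycle_class, Finset.card_pos]
  exact ⟨x, by simpa using Equiv.Perm.SameCycle.refl _ x⟩

lemma card_quot_pow {n : ℕ} (σ : Equiv.Perm (Fin n)) (k : ℕ) (hk : k ≠ 0) :
    (Nat.card (Quotient (Equiv.Perm.SameCycle.setoid (σ ^ k))) : ℚ) =
      ∑ p ∈ Finset.Icc 1 n,
        ((Finset.univ.filter fun x => minimalPeriod σ x = p).card / p : ℚ) * (Nat.gcd p k : ℚ) := by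
  rw [card_quot_eq]
  have hmaps : ∀ x ∈ (Finset.univ : Finset (Fin n)), minimalPeriod σ x ∈ Finset.Icc 1 n := by
    intro x _
    rw [Finset.mem_Icc]
    refine ⟨minimalPeriod_perm_pos σ x, ?_⟩
    rw [← card_sameCycle_class]
    exact (Finset.card_le_univ _).trans (by simp)
  rw [← Finset.sum_fiberwise_of_maps_to hmaps]
  refine Finset.sum_congr rfl fun p hp => ?_
  have hc : ∀ x ∈ Finset.univ.filter (fun x => minimalPeriod σ x = p),
      (1 : ℚ) / minimalPeriod (σ ^ k : Equiv.Perm (Fin n)) x = (Nat.gcd p k : ℚ) / p := by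
    intro x hx
    simp only [Finset.mem_filter, Finset.mem_univ, true_and] at hx
    rw [Equiv.Perm.coe_pow, minimalPeriod_iterate_eq_div_gcd hk, hx,
      Nat.cast_div (Nat.gcd_dvd_left p k), one_div_div]
    have := Nat.gcd_pos_of_pos_left k (Finset.mem_Icc.1 hp).1
    exact_mod_cast this.ne'
  rw [Finset.sum_congr rfl hc, Finset.sum_const, nsmul_eq_mul]
  ring

lemma count_cycleType {n : ℕ} (σ : Equiv.Perm (Fin n)) (p : ℕ) (hp : 2 ≤ p) :
    (Finset.univ.filter fun x => minimalPeriod σ x = p).card = σ.cycleType.count p * p := by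
  classical
  have hmoved : ∀ x, minimalPeriod σ x = p → x ∈ σ.support := by
    intro x hx
    rw [Equiv.Perm.mem_support]
    intro h
    have := minimalPeriod_eq_one_iff_isFixedPt.2 (show IsFixedPt σ x from h)
    omega
  have hcard : ∀ x ∈ σ.support, (σ.cycleOf x).support.card = minimalPeriod σ x := by
    intro x hx
    rw [← card_sameCycle_class]
    congr 1
    ext y
    simp [Equiv.Perm.mem_support_cycleOf_iff' (Equiv.Perm.mem_support.1 hx)]
  have hmaps : Set.MapsTo σ.cycleOf
      ((Finset.univ.filter fun x => minimalPeriod σ x = p : Finset (Fin n)) : Set (Fin n))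
      ((σ.cycleFactorsFinset.filter fun c => c.support.card = p : Finset _) : Set _) := by
    intro x hx
    simp only [Finset.coe_filter, Finset.mem_univ, true_and, Set.mem_ofPred_eq] at hx ⊢
    have h := hmoved x hx
    exact ⟨Equiv.Perm.cycleOf_mem_cycleFactorsFinset_iff.2 h, (hcard x h).trans hx⟩
  rw [Finset.card_eq_sum_card_fiberwise hmaps, Equiv.Perm.cycleType_def, Multiset.count_map]
  have hfib : ∀ c ∈ σ.cycleFactorsFinset.filter (fun c => c.support.card = p),
      ((Finset.univ.filter fun x => minimalPeriod σ x = p).filter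
        fun x => σ.cycleOf x = c).card = p := by
    intro c hc
    rw [Finset.mem_filter] at hc
    conv_rhs => rw [← hc.2]
    congr 1
    ext x
    simp only [Finset.mem_filter, Finset.mem_univ, true_and]
    constructor
    · rintro ⟨h1, rfl⟩
      rw [Equiv.Perm.mem_support_cycleOf_iff]
      exact ⟨Equiv.Perm.SameCycle.refl _ _, hmoved x h1⟩
    · intro hx
      have h1 := Equiv.Perm.cycle_is_cycleOf hx hc.1
      have h2 := Equiv.Perm.mem_cycleFactorsFinset_support_le hc.1 hx
      refine ⟨?_, h1.symm⟩
      rw [← hcard x h2, ← h1, hc.2]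
  rw [Finset.sum_congr rfl hfib, Finset.sum_const, smul_eq_mul]
  congr 1
  rw [← Finset.filter_val, Finset.card_def]
  congr 2
  ext c
  simp [eq_comm]

lemma permMatrix_isConj_of_isConj (F : Type*) [Field F] {n : ℕ}
    (σ τ : Equiv.Perm (Fin n)) (h : IsConj σ τ) :
    IsConj (σ.permMatrix F) (τ.permMatrix F) := by
  obtain ⟨c, hc⟩ := isConj_iff.1 h
  refine ⟨⟨c⁻¹.permMatrix F, c.permMatrix F, ?_, ?_⟩, ?_⟩
  · rw [← Matrix.permMatrix_mul]; simp
  · rw [← Matrix.permMatrix_mul]; simp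
  · change c⁻¹.permMatrix F * σ.permMatrix F = τ.permMatrix F * c⁻¹.permMatrix F
    rw [← Matrix.permMatrix_mul, ← Matrix.permMatrix_mul, ← hc]
    congr 1
    group

/-- Two permutation matrices over a finite field are conjugate in `GL_n(F_q)` if
and only if the permutations are conjugate in `S_n`, i.e. iff they have the same
cycle type. -/
theorem permMatrix_isConj_iff (F : Type*) [Field F] [Fintype F] (n : ℕ)
    (σ τ : Equiv.Perm (Fin n)) :
    (IsConj (σ.permMatrix F) (τ.permMatrix F) ↔ IsConj σ τ) ∧
      (IsConj σ τ ↔ σ.cycleType = τ.cycleType) := by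
  refine ⟨⟨fun h => ?_, permMatrix_isConj_of_isConj F σ τ⟩,
    Equiv.Perm.isConj_iff_cycleType_eq⟩
  rw [Equiv.Perm.isConj_iff_cycleType_eq]
  have key := gcdMatrix_inj n (fun p =>
    ((Finset.univ.filter fun x => minimalPeriod σ x = p).card / p : ℚ) -
    ((Finset.univ.filter fun x => minimalPeriod τ x = p).card / p : ℚ)) (by
      intro k hk
      have hk0 : k ≠ 0 := by have := (Finset.mem_Icc.1 hk).1; omega
      simp only [sub_mul, Finset.sum_sub_distrib]
      rw [← card_quot_pow σ k hk0, ← card_quot_pow τ k hk0,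
        card_quot_eq_of_isConj F σ τ h k, sub_self])
  ext p
  by_cases hp2 : 2 ≤ p
  · by_cases hpn : p ≤ n
    · have h1 := key p (Finset.mem_Icc.2 ⟨by omega, hpn⟩)
      have hp0 : (p : ℚ) ≠ 0 := by
        have : p ≠ 0 := by omega
        exact_mod_cast this
      simp only [count_cycleType _ p hp2] at h1
      push_cast at h1
      rw [mul_div_cancel_right₀ _ hp0, mul_div_cancel_right₀ _ hp0, sub_eq_zero] at h1
      exact_mod_cast h1
    · have hbig : ∀ ρ : Equiv.Perm (Fin n), ρ.cycleType.count p = 0 := by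
        intro ρ
        rw [Multiset.count_eq_zero]
        intro hm
        have h1 := Equiv.Perm.le_card_support_of_mem_cycleType hm
        have h2 := Finset.card_le_univ ρ.support
        rw [Fintype.card_fin] at h2
        omega
      rw [hbig, hbig]
  · have hsmall : ∀ ρ : Equiv.Perm (Fin n), ρ.cycleType.count p = 0 := by
      intro ρ
      rw [Multiset.count_eq_zero]
      exact fun hm => hp2 (Equiv.Perm.two_le_of_mem_cycleType hm)
    rw [hsmall, hsmall]
end
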